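/- For every finite subgraph G of T_∞, λ(G) + ∂(G) ≥ log₂(|E(G)| + 1). -/

import Mathlib

open scoped Classical

noncomputable section

namespace Paper

/-- A join-tree: a finite rooted binary tree whose leaves are labeled by
edges (elements of `Sym2 α`) or by `⊥` (here `none`). -/
inductive JoinTree (α : Type*) where
  | leaf : Option (Sym2 α) → JoinTree α
  | node : JoinTree α → JoinTree α → JoinTree α

variable {V : Type*}

/-- The vertex set of a finite edge set (a finite subgraph given by its edges). -/
def vset (F : Finset (Sym2 V)) : Set V := {v | ∃ e ∈ F, v ∈ e}

lemma vset_mono {F F' : Finset (Sym2 V)} (h : F ⊆ F') : vset F ⊆ vset F' := by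
  rintro v ⟨e, he, hv⟩
  exact ⟨e, h he, hv⟩

/-- `Δ_θ(F) = |V(F)| − Σ_{e ∈ E(F)} θ(e)`. -/
def Delta (θ : Sym2 V → ℝ) (F : Finset (Sym2 V)) : ℝ :=
  ((vset F).ncard : ℝ) - ∑ e ∈ F, θ e

/-- `θ` is a threshold weighting on the graph with edge set `E`:
it takes values in `[0,2]` on `E`, `Δ_θ(F) ≥ 0` for every finite subgraph `F ⊆ E`,
and `Δ_θ(E) = 0` whenever `E` is finite. -/
def IsThresholdWeighting (E : Set (Sym2 V)) (θ : Sym2 V → ℝ) : Prop :=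
  (∀ e ∈ E, 0 ≤ θ e ∧ θ e ≤ 2) ∧
  (∀ F : Finset (Sym2 V), (F : Set (Sym2 V)) ⊆ E → 0 ≤ Delta θ F) ∧
  (∀ hE : E.Finite, Delta θ hE.toFinset = 0)

/-- `F ⊖ S`: the union of the connected components of `F` that are vertex-disjoint
from `S`. -/
def elimS (F : Finset (Sym2 V)) (S : Set V) : Finset (Sym2 V) :=
  F.filter fun e =>
    ∀ v ∈ e, ∀ s ∈ S, ¬ (SimpleGraph.fromEdgeSet (F : Set (Sym2 V))).Reachable v s

/-- The graph with edge set `F` is connected. -/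
def ConnE (F : Finset (Sym2 V)) : Prop :=
  ∀ u ∈ vset F, ∀ w ∈ vset F, (SimpleGraph.fromEdgeSet (F : Set (Sym2 V))).Reachable u w

/-- The subgraph of `F` induced on a vertex set `T`. -/
def induced (F : Finset (Sym2 V)) (T : Set V) : Finset (Sym2 V) :=
  F.filter fun e => ∀ v ∈ e, v ∈ T

/-- Vertices of the infinite rootless layered binary tree `T_∞`: `(j, m)` is the
`m`-th vertex of level `j` (level `0` is the leaf level). -/
abbrev Vtx : Type := ℕ × ℕ

/-- The parent of a vertex of `T_∞`. -/
def parentV (v : Vtx) : Vtx := (v.1 + 1, v.2 / 2)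

/-- The edge set of `T_∞`: each vertex is joined to its parent. -/
def ETinf : Set (Sym2 Vtx) := { e | ∃ v : Vtx, e = s(v, parentV v) }

/-- `Desc v x`: `v` is a vertex of the complete binary tree `T_x` rooted at `x`
(i.e. a descendant of `x`, including `x` itself). -/
def Desc (v x : Vtx) : Prop := v.1 ≤ x.1 ∧ v.2 / 2 ^ (x.1 - v.1) = x.2

/-- The edge set of the complete binary tree `T_x` rooted at `x` inside `T_∞`. -/
def TxE (x : Vtx) : Set (Sym2 Vtx) :=
  { e | ∃ v : Vtx, Desc v x ∧ v ≠ x ∧ e = s(v, parentV v) }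

/-- The edge set of `T_x^+`: `T_x` together with the edge from `x` to its parent. -/
def TxPlusE (x : Vtx) : Set (Sym2 Vtx) := TxE x ∪ {s(x, parentV x)}

/-- `T_x ⊆ F` as subgraphs of `T_∞` (for `x` of level `0`, `T_x` is the single
vertex `x`, and containment means `x ∈ V(F)`). -/
def TxCont (x : Vtx) (F : Finset (Sym2 Vtx)) : Prop :=
  TxE x ⊆ (F : Set (Sym2 Vtx)) ∧ (x.1 = 0 → x ∈ vset F)

/-- The max-complete height `λ(F)`: the largest `k` such that `T_x ⊆ F` for some
vertex `x` of level `k` (and `0` if there is no such `x`). -/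
def lam (F : Finset (Sym2 Vtx)) : ℕ := sSup { k | ∃ x : Vtx, x.1 = k ∧ TxCont x F }

/-- The boundary size `∂(F) = |V(F) ∩ V(T_∞ \ F)|`. -/
def bdry (F : Finset (Sym2 Vtx)) : ℕ :=
  (vset F ∩ {v | ∃ e ∈ ETinf, e ∉ F ∧ v ∈ e}).ncard

/-- The threshold weighting on `T_∞` induced by the uniform random walk:
`2/3` on edges containing a leaf, `4/3` otherwise. -/
def thetaT : Sym2 Vtx → ℝ := fun e => if ∃ v ∈ e, v.1 = 0 then 2 / 3 else 4 / 3

/-- The edges of `G`, each represented by its lower endpoint. -/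
def lowerEnds (G : Finset (Sym2 Vtx)) : Set Vtx := {v | s(v, parentV v) ∈ G}

/-- The set of boundary vertices of `G`. -/
def bdrySet (G : Finset (Sym2 Vtx)) : Set Vtx := vset G ∩ {v | ∃ e ∈ ETinf, e ∉ G ∧ v ∈ e}

/-- The number of elements of `A` lying in the complete binary tree `T_x`. -/
def descCount (A : Finset Vtx) (x : Vtx) : ℕ := (A.filter fun v => Desc v x).card

lemma vset_finite {V : Type*} (F : Finset (Sym2 V)) : (vset F).Finite := by
  have : vset F = ⋃ e ∈ F, {v | v ∈ e} := by
    ext v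
    simp [vset]
  rw [this]
  refine F.finite_toSet.biUnion fun e _ => ?_
  induction e with
  | _ a b => exact (Set.toFinite {a, b}).subset fun v hv => by simpa using hv

lemma lowerEnds_finite (G : Finset (Sym2 Vtx)) : (lowerEnds G).Finite :=
  (vset_finite G).subset fun _ hv => ⟨_, hv, Sym2.mem_mk_left _ _⟩

lemma bdrySet_finite (G : Finset (Sym2 Vtx)) : (bdrySet G).Finite :=
  (vset_finite G).subset Set.inter_subset_left

lemma parent_edge_injective : Function.Injective fun v : Vtx => s(v, parentV v) := by
  intro v w h
  rcases Sym2.eq_iff.1 h with h | h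
  · exact h.1
  · have h1 := congrArg Prod.fst h.1
    have h2 := congrArg Prod.fst h.2
    simp only [parentV] at h1 h2
    omega

lemma card_lowerEnds {G : Finset (Sym2 Vtx)} (hG : (G : Set (Sym2 Vtx)) ⊆ ETinf) :
    (lowerEnds_finite G).toFinset.card = G.card := by
  rw [← Finset.card_image_of_injective _ parent_edge_injective]
  congr 1
  ext e
  simp only [Finset.mem_image, Set.Finite.mem_toFinset]
  constructor
  · rintro ⟨v, hv, rfl⟩
    exact hv
  · intro he
    obtain ⟨v, rfl⟩ := hG he
    exact ⟨v, he, rfl⟩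

lemma parentV_even (k m : ℕ) : parentV (k, 2 * m) = (k + 1, m) := by
  simp [parentV]

lemma parentV_odd (k m : ℕ) : parentV (k, 2 * m + 1) = (k + 1, m) := by
  simp only [parentV, Prod.mk.injEq, true_and]
  omega

lemma desc_zero_iff {v : Vtx} {m : ℕ} : Desc v (0, m) ↔ v = (0, m) := by
  obtain ⟨j, n⟩ := v
  simp only [Desc, Prod.mk.injEq]
  constructor
  · rintro ⟨h, h'⟩
    obtain rfl : j = 0 := by omega
    simpa using h'
  · rintro ⟨rfl, rfl⟩
    simp

lemma desc_succ_iff {v : Vtx} {k m : ℕ} :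
    Desc v (k + 1, m) ↔ v = (k + 1, m) ∨ Desc v (k, 2 * m) ∨ Desc v (k, 2 * m + 1) := by
  obtain ⟨j, n⟩ := v
  simp only [Desc, Prod.mk.injEq]
  by_cases hj : j ≤ k
  · have h : k + 1 - j = k - j + 1 := by omega
    rw [h, pow_succ, ← Nat.div_div_eq_div_mul]
    omega
  · by_cases hj' : j = k + 1
    · subst hj'
      simp
    · omega

lemma descCount_zero_le (A : Finset Vtx) (m : ℕ) : descCount A (0, m) ≤ 1 := by
  refine Finset.card_le_one.2 fun a ha b hb => ?_
  simp only [Finset.mem_filter, desc_zero_iff] at ha hb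
  rw [ha.2, hb.2]

lemma descCount_zero_of_notMem {A : Finset Vtx} {m : ℕ} (h : (0, m) ∉ A) :
    descCount A (0, m) = 0 := by
  refine Finset.card_eq_zero.2 (Finset.filter_eq_empty_iff.2 fun v hv hd => h ?_)
  rwa [← desc_zero_iff.1 hd]

lemma descCount_succ (A : Finset Vtx) (k m : ℕ) :
    descCount A (k + 1, m) = descCount A (k, 2 * m) + descCount A (k, 2 * m + 1) +
      if (k + 1, m) ∈ A then 1 else 0 := by
  have h : (A.filter fun v => Desc v (k + 1, m)) =
      ((A.filter fun v => Desc v (k, 2 * m)) ∪ A.filter fun v => Desc v (k, 2 * m + 1)) ∪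
        A.filter fun v => v = (k + 1, m) := by
    ext v
    simp only [Finset.mem_filter, Finset.mem_union, desc_succ_iff]
    tauto
  unfold descCount
  rw [h, Finset.card_union_of_disjoint, Finset.card_union_of_disjoint, Finset.filter_eq']
  · split_ifs <;> simp
  · refine Finset.disjoint_filter.2 fun v _ h1 h2 => ?_
    have := h1.2.symm.trans h2.2
    simp only at this
    omega
  · rw [← Finset.filter_or]
    refine Finset.disjoint_filter.2 ?_
    rintro _ - (h1 | h1) rfl <;> simp [Desc] at h1

lemma descCount_add_one_le (A : Finset Vtx) (k m : ℕ) :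
    descCount A (k, m) + 1 ≤ 2 ^ (k + 1) := by
  induction k generalizing m with
  | zero => simpa using descCount_zero_le A m
  | succ k ih =>
    rw [descCount_succ, pow_succ]
    have := ih (2 * m)
    have := ih (2 * m + 1)
    split_ifs <;> omega

lemma txCont_zero {G : Finset (Sym2 Vtx)} {m : ℕ} (h : (0, m) ∈ lowerEnds G) :
    TxCont (0, m) G := by
  refine ⟨?_, fun _ => ⟨_, h, Sym2.mem_mk_left _ _⟩⟩
  rintro e ⟨v, hv, hne, -⟩
  exact absurd (desc_zero_iff.1 hv) hne

lemma txCont_succ {G : Finset (Sym2 Vtx)} {k m : ℕ}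
    (hy : (k, 2 * m) ∈ lowerEnds G) (hz : (k, 2 * m + 1) ∈ lowerEnds G)
    (hTy : TxCont (k, 2 * m) G) (hTz : TxCont (k, 2 * m + 1) G) : TxCont (k + 1, m) G := by
  refine ⟨?_, fun h => by simp at h⟩
  rintro e ⟨v, hv, hne, rfl⟩
  rcases desc_succ_iff.1 hv with h | h | h
  · exact absurd h hne
  · by_cases hv' : v = (k, 2 * m)
    · rw [hv']
      exact hy
    · exact hTy.1 ⟨v, h, hv', rfl⟩
  · by_cases hv' : v = (k, 2 * m + 1)
    · rw [hv']
      exact hz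
    · exact hTz.1 ⟨v, h, hv', rfl⟩

lemma mem_vset_of_txCont {G : Finset (Sym2 Vtx)} {x : Vtx} (h : TxCont x G) : x ∈ vset G := by
  obtain ⟨k, m⟩ := x
  cases k with
  | zero => exact h.2 rfl
  | succ k =>
    refine ⟨_, h.1 ⟨(k, 2 * m), ?_, by simp, rfl⟩, ?_⟩
    · simp [Desc]
    · rw [parentV_even]
      exact Sym2.mem_mk_right _ _

lemma le_lam {G : Finset (Sym2 Vtx)} {x : Vtx} (h : TxCont x G) : x.1 ≤ lam G := by
  refine le_csSup (((vset_finite G).image Prod.fst).subset ?_).bddAbove ⟨x, rfl, h⟩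
  rintro _ ⟨y, rfl, hy⟩
  exact ⟨y, mem_vset_of_txCont hy, rfl⟩

lemma mem_bdrySet {G : Finset (Sym2 Vtx)} {x v w : Vtx} (hv : v ∈ lowerEnds G)
    (hw : w ∉ lowerEnds G) (hxv : x ∈ s(v, parentV v)) (hxw : x ∈ s(w, parentV w)) :
    x ∈ bdrySet G :=
  ⟨⟨_, hv, hxv⟩, _, ⟨w, rfl⟩, hw, hxw⟩

lemma two_pow_add_le {l a b : ℕ} (ha : 1 ≤ a) (hb : 1 ≤ b) :
    2 ^ (l + a) + 2 ^ (l + b) ≤ 2 ^ (l + a + b) := by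
  have h1 : 2 ^ (l + a) ≤ 2 ^ (l + a + b - 1) := Nat.pow_le_pow_right two_pos (by omega)
  have h2 : 2 ^ (l + b) ≤ 2 ^ (l + a + b - 1) := Nat.pow_le_pow_right two_pos (by omega)
  have h3 : 2 ^ (l + a + b) = 2 * 2 ^ (l + a + b - 1) := by
    rw [← pow_succ']
    congr 1
    omega
  omega

lemma add_add_one_le_two_pow {l a b E F : ℕ} (hE : E + 1 ≤ 2 ^ (l + a)) (hF : F + 1 ≤ 2 ^ (l + b))
    (ha : a = 0 → E = 0) (hb : b = 0 → F = 0) : E + F + 1 ≤ 2 ^ (l + a + b) := by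
  rcases Nat.eq_zero_or_pos a with rfl | ha'
  · simpa [ha rfl] using hF
  · rcases Nat.eq_zero_or_pos b with rfl | hb'
    · simpa [hb rfl] using hE
    · have := two_pow_add_le (l := l) ha' hb'
      omega

/-- Bounds for the number of edges of `G` in `T_x` together with the edge above `x`, in terms of
the number of boundary vertices of `G` in `T_x`. -/
lemma descCount_bounds (G : Finset (Sym2 Vtx)) (k m : ℕ) :
    let E := descCount (lowerEnds_finite G).toFinset (k, m)
    let D := descCount (bdrySet_finite G).toFinset (k, m)
    ((k, m) ∈ lowerEnds G → (D = 0 → TxCont (k, m) G) ∧ E + 1 ≤ 2 ^ (lam G + (D + 1))) ∧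
      ((k, m) ∉ lowerEnds G → (D = 0 → E = 0) ∧ E + 1 ≤ 2 ^ (lam G + D)) := by
  induction k generalizing m with
  | zero =>
    intro E D
    refine ⟨fun h => ⟨fun _ => txCont_zero h, ?_⟩, fun h => ?_⟩
    · have h1 : E ≤ 1 := descCount_zero_le _ m
      have h2 : 2 ^ 1 ≤ 2 ^ (lam G + (D + 1)) := Nat.pow_le_pow_right two_pos (by omega)
      omega
    · have h1 : E = 0 := descCount_zero_of_notMem (by simpa using h)
      exact ⟨fun _ => h1, by rw [h1]; exact Nat.one_le_two_pow⟩
  | succ k ih =>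
    have hsize := descCount_add_one_le (lowerEnds_finite G).toFinset (k + 1) m
    have hE := descCount_succ (lowerEnds_finite G).toFinset k m
    have hD := descCount_succ (bdrySet_finite G).toFinset k m
    simp only [Set.Finite.mem_toFinset] at hE hD
    have ihy := ih (2 * m)
    have ihz := ih (2 * m + 1)
    have hxx : ((k + 1, m) : Vtx) ∈ s((k + 1, m), parentV (k + 1, m)) := Sym2.mem_mk_left _ _
    have hxy : ((k + 1, m) : Vtx) ∈ s((k, 2 * m), parentV (k, 2 * m)) := by
      rw [parentV_even]
      exact Sym2.mem_mk_right _ _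
    have hxz : ((k + 1, m) : Vtx) ∈ s((k, 2 * m + 1), parentV (k, 2 * m + 1)) := by
      rw [parentV_odd]
      exact Sym2.mem_mk_right _ _
    have hTy := fun h : TxCont (k, 2 * m) G => le_lam h
    have hTz := fun h : TxCont (k, 2 * m + 1) G => le_lam h
    have hTx := fun h : TxCont (k + 1, m) G => le_lam h
    dsimp only at ihy ihz hTy hTz hTx ⊢
    generalize descCount (lowerEnds_finite G).toFinset (k + 1, m) = E at *
    generalize descCount (lowerEnds_finite G).toFinset (k, 2 * m) = Ey at *
    generalize descCount (lowerEnds_finite G).toFinset (k, 2 * m + 1) = Ez at *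
    generalize descCount (bdrySet_finite G).toFinset (k + 1, m) = D at *
    generalize descCount (bdrySet_finite G).toFinset (k, 2 * m) = Dy at *
    generalize descCount (bdrySet_finite G).toFinset (k, 2 * m + 1) = Dz at *
    have hmixed : ∀ {a b : ℕ}, Ey + 1 ≤ 2 ^ (lam G + a) → Ez + 1 ≤ 2 ^ (lam G + b) →
        (a = 0 → Ey = 0) → (b = 0 → Ez = 0) → E ≤ Ey + Ez + 1 →
        ((k + 1, m) ∉ lowerEnds G → E = Ey + Ez) → a + b ≤ D →
        E + 1 ≤ 2 ^ (lam G + (D + 1)) ∧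
          ((k + 1, m) ∉ lowerEnds G → E + 1 ≤ 2 ^ (lam G + D)) := by
      intro a b ha hb ha0 hb0 hle heq hab
      have h1 := add_add_one_le_two_pow ha hb ha0 hb0
      have h2 : 2 ^ (lam G + a + b) ≤ 2 ^ (lam G + D) :=
        Nat.pow_le_pow_right two_pos (by omega)
      rw [← add_assoc, pow_succ]
      exact ⟨by omega, fun h => by have := heq h; omega⟩
    by_cases hy : (k, 2 * m) ∈ lowerEnds G <;> by_cases hz : (k, 2 * m + 1) ∈ lowerEnds G
    · obtain ⟨hy0, hyE⟩ := ihy.1 hy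
      obtain ⟨hz0, hzE⟩ := ihz.1 hz
      have hfull : Dy = 0 → Dz = 0 → TxCont (k + 1, m) G := fun h h' =>
        txCont_succ hy hz (hy0 h) (hz0 h')
      have hlevel : ∀ {a : ℕ}, k + 2 ≤ a → E + 1 ≤ 2 ^ a := fun h =>
        hsize.trans (Nat.pow_le_pow_right two_pos h)
      have hadd : 1 ≤ Dy → 1 ≤ Dz →
          2 ^ (lam G + (Dy + 1)) + 2 ^ (lam G + (Dz + 1)) ≤ 2 ^ (lam G + (Dy + Dz + 1)) := by
        intro h h'
        have := two_pow_add_le (l := lam G + 1) h h'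
        rwa [add_assoc (lam G) 1 Dy, add_assoc (lam G) 1 Dz, add_comm 1 Dy, add_comm 1 Dz,
          show lam G + (Dy + 1) + Dz = lam G + (Dy + Dz + 1) by ring] at this
      have hlam : ¬(1 ≤ Dy ∧ 1 ≤ Dz) → k ≤ lam G ∧ (Dy = 0 ∧ Dz = 0 → k + 1 ≤ lam G) := by
        refine fun hpos => ⟨?_, fun h => hTx (hfull h.1 h.2)⟩
        rcases Nat.eq_zero_or_pos Dy with h | h
        · exact hTy (hy0 h)
        · exact hTz (hz0 (by omega))
      refine ⟨fun hx => ?_, fun hx => ?_⟩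
      · rw [if_pos hx] at hE
        refine ⟨fun h => hfull (by omega) (by omega), ?_⟩
        by_cases hpos : 1 ≤ Dy ∧ 1 ≤ Dz
        · have h1 := hadd hpos.1 hpos.2
          have h2 : 2 ^ (lam G + (Dy + Dz + 1)) ≤ 2 ^ (lam G + (D + 1)) :=
            Nat.pow_le_pow_right two_pos (by omega)
          omega
        · have := hlam hpos
          apply hlevel
          omega
      · rw [if_neg hx] at hE
        rw [if_pos (mem_bdrySet hy hx hxy hxx)] at hD
        refine ⟨fun h => by omega, ?_⟩
        by_cases hpos : 1 ≤ Dy ∧ 1 ≤ Dz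
        · have h1 := hadd hpos.1 hpos.2
          rw [hD]
          omega
        · have := hlam hpos
          apply hlevel
          omega
    · obtain ⟨hy0, hyE⟩ := ihy.1 hy
      obtain ⟨hz0, hzE⟩ := ihz.2 hz
      rw [if_pos (mem_bdrySet hy hz hxy hxz)] at hD
      have := hmixed hyE hzE (by omega) hz0 (by split_ifs at hE <;> omega)
        (fun h => by rw [if_neg h] at hE; exact hE) (by omega)
      exact ⟨fun _ => ⟨by omega, this.1⟩, fun h => ⟨by omega, this.2 h⟩⟩
    · obtain ⟨hy0, hyE⟩ := ihy.2 hy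
      obtain ⟨hz0, hzE⟩ := ihz.1 hz
      rw [if_pos (mem_bdrySet hz hy hxz hxy)] at hD
      have := hmixed hyE hzE hy0 (by omega) (by split_ifs at hE <;> omega)
        (fun h => by rw [if_neg h] at hE; exact hE) (by omega)
      exact ⟨fun _ => ⟨by omega, this.1⟩, fun h => ⟨by omega, this.2 h⟩⟩
    · obtain ⟨hy0, hyE⟩ := ihy.2 hy
      obtain ⟨hz0, hzE⟩ := ihz.2 hz
      have := hmixed hyE hzE hy0 hz0 (by split_ifs at hE <;> omega)
        (fun h => by rw [if_neg h] at hE; exact hE) (by split_ifs at hD <;> omega)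
      refine ⟨fun hx => ?_, fun hx => ⟨fun h => ?_, this.2 hx⟩⟩
      · rw [if_pos (mem_bdrySet hx hy hxx hxy)] at hD
        exact ⟨by omega, this.1⟩
      · rw [if_neg hx] at hE
        have := hy0 (by split_ifs at hD <;> omega)
        have := hz0 (by split_ifs at hD <;> omega)
        omega

lemma exists_desc_of_finite {S : Set Vtx} (hS : S.Finite) :
    ∃ k : ℕ, ∀ v ∈ S, v.1 < k ∧ Desc v (k, 0) := by
  obtain ⟨N, hN⟩ := (hS.image fun v => v.1 + v.2).bddAbove
  refine ⟨N + 1, fun v hv => ?_⟩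
  have h : v.1 + v.2 ≤ N := hN ⟨v, hv, rfl⟩
  refine ⟨by omega, by simp only; omega, Nat.div_eq_of_lt ?_⟩
  exact Nat.lt_two_pow_self.trans_le (Nat.pow_le_pow_right two_pos (by simp only; omega))

lemma card_add_one_le {G : Finset (Sym2 Vtx)} (hG : (G : Set (Sym2 Vtx)) ⊆ ETinf) :
    G.card + 1 ≤ 2 ^ (lam G + bdry G) := by
  obtain ⟨k, hk⟩ := exists_desc_of_finite (vset_finite G)
  have hle : lowerEnds G ⊆ vset G := fun v hv => ⟨_, hv, Sym2.mem_mk_left _ _⟩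
  have h := ((descCount_bounds G k 0).2 fun h => lt_irrefl _ (hk _ (hle h)).1).2
  have hE : descCount (lowerEnds_finite G).toFinset (k, 0) = G.card := by
    rw [← card_lowerEnds hG]
    exact congrArg _ (Finset.filter_true_of_mem fun v hv =>
      (hk v (hle ((lowerEnds_finite G).mem_toFinset.1 hv))).2)
  have hD : descCount (bdrySet_finite G).toFinset (k, 0) = bdry G := by
    refine Eq.trans ?_ (Set.ncard_eq_toFinset_card (bdrySet G) (bdrySet_finite G)).symm
    exact congrArg _ (Finset.filter_true_of_mem fun v hv =>
      (hk v ((bdrySet_finite G).mem_toFinset.1 hv).1).2)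
  rwa [hE, hD] at h

/-- For every finite subgraph `G` of `T_∞`,
`λ(G) + ∂(G) ≥ log₂(|E(G)| + 1)`. -/
theorem stmt5 (G : Finset (Sym2 Vtx)) (hG : (G : Set (Sym2 Vtx)) ⊆ ETinf) :
    Real.logb 2 ((G.card : ℝ) + 1) ≤ (lam G : ℝ) + (bdry G : ℝ) := by
  have h : (G.card : ℝ) + 1 ≤ (2 : ℝ) ^ (lam G + bdry G) := by
    exact_mod_cast card_add_one_le hG
  rw [Real.logb_le_iff_le_rpow one_lt_two (by positivity)]
  exact_mod_cast h

end Paper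

end
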